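/- Let s ≥ 2, m ≥ 1, 1 ≤ j ≤ m and k ≥ s+j. Then Γ_{s+j}^{[s,s+m]×k} = 8^{j−1} · Γ_{s+1}^{[s, s+m−j+1]×(k−j+1)}. -/

import Mathlib

open Matrix

/-- The `a × k` Hankel (persymmetric) matrix over `F_2` whose `(i,j)` entry is `α (i+j)`. -/
def hankel (a k : ℕ) (α : Fin (a + k - 1) → ZMod 2) :
    Matrix (Fin a) (Fin k) (ZMod 2) :=
  Matrix.of fun i j => α ⟨(i : ℕ) + (j : ℕ), by have := i.isLt; have := j.isLt; omega⟩

/-- `Γ_i^{[a,b]×k}` : the number of pairs `(α, β)` such that the `(a+b) × k` matrix obtained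
by stacking the `a × k` Hankel matrix of `α` on top of the `b × k` Hankel matrix of `β`
has rank `i` over `F_2`. -/
noncomputable def Gamma (a b k i : ℕ) : ℕ :=
  Nat.card {p : (Fin (a + k - 1) → ZMod 2) × (Fin (b + k - 1) → ZMod 2) //
    (Matrix.fromRows (hankel a k p.1) (hankel b k p.2)).rank = i}

open Polynomial

section Structure

variable {K : Type*} [Field K]

theorem mul_mem_degreeLT {p q : K[X]} {a b n : ℕ} (hp : p ∈ degreeLT K a)
    (hq : q ∈ degreeLT K b) (h : a + b ≤ n + 1) : p * q ∈ degreeLT K n := by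
  rcases eq_or_ne p 0 with rfl | hp0
  · simp
  rcases eq_or_ne q 0 with rfl | hq0
  · simp
  rw [mem_degreeLT, ← natDegree_lt_iff_degree_lt hp0] at hp
  rw [mem_degreeLT, ← natDegree_lt_iff_degree_lt hq0] at hq
  rw [mem_degreeLT, ← natDegree_lt_iff_degree_lt (mul_ne_zero hp0 hq0), natDegree_mul hp0 hq0]
  omega

theorem X_pow_mem_degreeLT {i n : ℕ} (h : i < n) : (X ^ i : K[X]) ∈ degreeLT K n := by
  rw [mem_degreeLT, degree_X_pow]
  exact_mod_cast h

theorem mem_degreeLT_of_mul_mem {f p : K[X]} {n : ℕ} (hf : f ≠ 0)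
    (h : f * p ∈ degreeLT K (f.natDegree + n)) : p ∈ degreeLT K n := by
  rcases eq_or_ne p 0 with rfl | hp0
  · simp
  rw [mem_degreeLT, ← natDegree_lt_iff_degree_lt (mul_ne_zero hf hp0), natDegree_mul hf hp0] at h
  rw [mem_degreeLT, ← natDegree_lt_iff_degree_lt hp0]
  omega

instance (n : ℕ) : FiniteDimensional K (degreeLT K n) :=
  (degreeLTEquiv K n).symm.finiteDimensional

theorem finrank_degreeLT' (n : ℕ) : Module.finrank K (degreeLT K n) = n := by
  rw [(degreeLTEquiv K n).finrank_eq, Module.finrank_fin_fun]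

/-- Functionals agreeing on the monomials `1, X, …, X ^ (n - 1)` agree in degree less than `n`. -/
theorem eqOn_degreeLT {φ ψ : K[X] →ₗ[K] K} {n : ℕ} (h : ∀ i < n, φ (X ^ i) = ψ (X ^ i))
    {p : K[X]} (hp : p ∈ degreeLT K n) : φ p = ψ p := by
  classical
  have : degreeLT K n ≤ LinearMap.eqLocus φ ψ := by
    rw [degreeLT_eq_span_X_pow, Submodule.span_le]
    intro x hx
    simp only [Finset.coe_image, Finset.coe_range, Set.mem_image, Set.mem_Iio] at hx
    obtain ⟨i, hi, rfl⟩ := hx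
    exact h i hi
  exact this hp

/-- The kernel of the `b × k` Hankel matrix of the sequence `i ↦ φ (X ^ i)`, as a space of
polynomials. -/
def hankelKer (φ : K[X] →ₗ[K] K) (b k : ℕ) : Submodule K K[X] where
  carrier := {v | v ∈ degreeLT K k ∧ ∀ i < b, φ (v * X ^ i) = 0}
  add_mem' := fun hv hw => ⟨add_mem hv.1 hw.1, fun i hi => by
    rw [add_mul, map_add, hv.2 i hi, hw.2 i hi, add_zero]⟩
  zero_mem' := ⟨zero_mem _, fun i _ => by simp⟩
  smul_mem' := fun c v hv => ⟨Submodule.smul_mem _ c hv.1, fun i hi => by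
    rw [smul_mul_assoc, map_smul, hv.2 i hi, smul_zero]⟩

theorem mem_hankelKer {φ : K[X] →ₗ[K] K} {b k : ℕ} {v : K[X]} :
    v ∈ hankelKer φ b k ↔ v ∈ degreeLT K k ∧ ∀ i < b, φ (v * X ^ i) = 0 := Iff.rfl

theorem hankelKer_le (φ : K[X] →ₗ[K] K) (b k : ℕ) : hankelKer φ b k ≤ degreeLT K k :=
  fun _ hv => hv.1

instance (φ : K[X] →ₗ[K] K) (b k : ℕ) : FiniteDimensional K (hankelKer φ b k) :=
  Submodule.finiteDimensional_of_le (hankelKer_le φ b k)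

theorem apply_mul_of_mem_hankelKer {φ : K[X] →ₗ[K] K} {b k : ℕ} {v w : K[X]}
    (hv : v ∈ hankelKer φ b k) (hw : w ∈ degreeLT K b) : φ (v * w) = 0 :=
  eqOn_degreeLT (φ := φ ∘ₗ LinearMap.mulLeft K v) (ψ := 0) (by simpa using hv.2) hw

theorem mul_mem_hankelKer {φ : K[X] →ₗ[K] K} {b k b' k' u : ℕ} {v w : K[X]}
    (hv : v ∈ hankelKer φ b k) (hw : w ∈ degreeLT K u) (hk : k + u ≤ k' + 1)
    (hb : b' + u ≤ b + 1) : v * w ∈ hankelKer φ b' k' := by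
  refine ⟨mul_mem_degreeLT hv.1 hw hk, fun i hi => ?_⟩
  rw [mul_assoc]
  refine apply_mul_of_mem_hankelKer hv
    (mul_mem_degreeLT hw (X_pow_mem_degreeLT (Nat.lt_succ_self i)) (by omega))

theorem hankelKer_mono (φ : K[X] →ₗ[K] K) {b k b' k' : ℕ} (hb : b' ≤ b) (hk : k ≤ k') :
    hankelKer φ b k ≤ hankelKer φ b' k' := fun _ hv =>
  ⟨degreeLT_mono hk hv.1, fun i hi => hv.2 i (by omega)⟩

/-- Rank-nullity for a matrix whose kernel is described by a space of polynomials. -/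
theorem rank_add_finrank {ι : Type*} [Fintype ι] {k : ℕ} (B : Matrix ι (Fin k) K)
    (J : Submodule K K[X]) (hJ : J ≤ degreeLT K k)
    (h : ∀ v : Fin k → K, ((degreeLTEquiv K k).symm v : K[X]) ∈ J ↔ B.mulVec v = 0) :
    B.rank + Module.finrank K J = k := by
  have e : J = (LinearMap.ker B.mulVecLin).map
      ((degreeLT K k).subtype ∘ₗ (degreeLTEquiv K k).symm.toLinearMap) := by
    ext p
    simp only [Submodule.mem_map, LinearMap.mem_ker, Matrix.mulVecLin_apply,
      LinearMap.comp_apply, Submodule.subtype_apply, LinearEquiv.coe_coe]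
    constructor
    · intro hp
      refine ⟨degreeLTEquiv K k ⟨p, hJ hp⟩, ?_, by simp⟩
      rw [← h]
      simpa using hp
    · rintro ⟨v, hv, rfl⟩
      exact (h v).2 hv
  have hinj : Function.Injective
      ((degreeLT K k).subtype ∘ₗ (degreeLTEquiv K k).symm.toLinearMap) := by
    rw [LinearMap.coe_comp]
    exact Subtype.val_injective.comp (degreeLTEquiv K k).symm.injective
  rw [e, ← (Submodule.equivMapOfInjective _ hinj _).finrank_eq, Matrix.rank,
    LinearMap.finrank_range_add_finrank_ker, Module.finrank_fin_fun]

theorem apply_degreeLTEquiv_symm_mul (φ : K[X] →ₗ[K] K) {k : ℕ} (v : Fin k → K) (i : ℕ) :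
    φ (((degreeLTEquiv K k).symm v : K[X]) * X ^ i) = ∑ j : Fin k, φ (X ^ (i + j)) * v j := by
  have : ((degreeLTEquiv K k).symm v : K[X]) = ∑ j : Fin k, v j • X ^ (j : ℕ) := by
    simp [degreeLTEquiv, ← C_mul_X_pow_eq_monomial, smul_eq_C_mul]
  rw [this, Finset.sum_mul, map_sum]
  refine Finset.sum_congr rfl fun j _ => ?_
  rw [smul_mul_assoc, map_smul, ← pow_add, smul_eq_mul, mul_comm, add_comm]

theorem rank_add_finrank_hankelKer (φ : K[X] →ₗ[K] K) (b k : ℕ) :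
    (Matrix.of fun (i : Fin b) (j : Fin k) => φ (X ^ ((i : ℕ) + j))).rank
      + Module.finrank K (hankelKer φ b k) = k := by
  refine rank_add_finrank _ _ (hankelKer_le φ b k) fun v => ?_
  rw [mem_hankelKer, and_iff_right (Subtype.prop _), funext_iff, Fin.forall_iff]
  refine forall_congr' fun i => forall_congr' fun hi => ?_
  rw [apply_degreeLTEquiv_symm_mul]
  rfl

theorem finrank_hankelKer_comm (φ : K[X] →ₗ[K] K) (b k : ℕ) :
    b + Module.finrank K (hankelKer φ b k) = k + Module.finrank K (hankelKer φ k b) := by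
  have h1 := rank_add_finrank_hankelKer φ b k
  have h2 := rank_add_finrank_hankelKer φ k b
  rw [← Matrix.rank_transpose] at h2
  have : (Matrix.of fun (i : Fin k) (j : Fin b) => φ (X ^ ((i : ℕ) + j))).transpose
      = Matrix.of fun (i : Fin b) (j : Fin k) => φ (X ^ ((i : ℕ) + j)) := by
    ext i j
    simp [add_comm]
  rw [this] at h2
  omega

theorem le_finrank_hankelKer (φ : K[X] →ₗ[K] K) (b k : ℕ) :
    k ≤ b + Module.finrank K (hankelKer φ b k) := by
  have := finrank_hankelKer_comm φ b k
  omega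

theorem finrank_hankelKer_lt {φ : K[X] →ₗ[K] K} {b k : ℕ} (h : hankelKer φ (b + 1) k ≠ ⊥) :
    Module.finrank K (hankelKer φ (b + 1) k) < Module.finrank K (hankelKer φ b (k + 1)) := by
  refine Submodule.finrank_lt_finrank_of_lt
    (lt_of_le_of_ne (hankelKer_mono φ b.le_succ k.le_succ) fun heq => ?_)
  obtain ⟨f, hf, hf0⟩ := Submodule.exists_mem_ne_zero_of_ne_bot h
  have key : ∀ i : ℕ, f * X ^ i ∈ hankelKer φ (b + 1) k := by
    intro i
    induction i with
    | zero => simpa using hf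
    | succ i ih =>
      rw [pow_succ, ← mul_assoc, heq]
      exact mul_mem_hankelKer (u := 2) ih (by simpa using X_pow_mem_degreeLT (K := K) one_lt_two)
        le_rfl le_rfl
  have := (key k).1
  rw [mem_degreeLT, ← natDegree_lt_iff_degree_lt (by simp [hf0]), natDegree_mul_X_pow _ hf0] at this
  omega

theorem finrank_hankelKer_le_of_eq_bot {φ : K[X] →ₗ[K] K} {d : ℕ} (u v : ℕ)
    (h : hankelKer φ (d + u + v) d = ⊥) :
    Module.finrank K (hankelKer φ (d + v) (d + u)) ≤ u := by
  induction v generalizing u with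
  | zero =>
    have := finrank_hankelKer_comm φ (d + 0) (d + u)
    rw [add_zero] at h this ⊢
    rw [h, finrank_bot] at this
    omega
  | succ v ih =>
    have := ih (u + 1) (by rw [← h]; congr 1; omega)
    by_cases h0 : hankelKer φ (d + v + 1) (d + u) = ⊥
    · rw [← add_assoc, h0, finrank_bot]
      omega
    · have := finrank_hankelKer_lt h0
      rw [← add_assoc]
      rw [← add_assoc] at *
      omega

/-- In the middle range, the kernel of a Hankel matrix consists of the multiples of a single
polynomial. -/
theorem hankelKer_eq_map {φ : K[X] →ₗ[K] K} {d u v : ℕ} (h : hankelKer φ (d + u + v) d = ⊥)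
    {f : K[X]} (hf : f ∈ hankelKer φ (d + u + v - 1) (d + 1)) (hf0 : f ≠ 0) :
    hankelKer φ (d + v) (d + u) = (degreeLT K u).map (LinearMap.mulLeft K f) := by
  rcases Nat.eq_zero_or_pos u with rfl | hu
  · have h1 := finrank_hankelKer_le_of_eq_bot 0 v h
    rw [Nat.le_zero, Submodule.finrank_eq_zero] at h1
    rw [h1, eq_comm, eq_bot_iff]
    rintro _ ⟨x, hx, rfl⟩
    have : x = 0 := by simpa [mem_degreeLT] using hx
    simp [this]
  symm
  apply Submodule.eq_of_le_of_finrank_le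
  · rintro _ ⟨p, hp, rfl⟩
    exact mul_mem_hankelKer hf hp (by omega) (by omega)
  · rw [← (Submodule.equivMapOfInjective _ (mul_right_injective₀ hf0) _).finrank_eq,
      finrank_degreeLT']
    exact finrank_hankelKer_le_of_eq_bot u v h

open Classical in
/-- The largest `n` for which the `(M - n) × n` Hankel matrix has trivial kernel. -/
noncomputable def hankelIndex (φ : K[X] →ₗ[K] K) (M : ℕ) : ℕ :=
  Nat.findGreatest (fun n => hankelKer φ (M - n) n = ⊥) M

theorem hankelKer_zero (φ : K[X] →ₗ[K] K) (b : ℕ) : hankelKer φ b 0 = ⊥ := by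
  rw [eq_bot_iff]
  intro x hx
  simpa [mem_degreeLT] using hx.1

theorem hankelKer_hankelIndex (φ : K[X] →ₗ[K] K) (M : ℕ) :
    hankelKer φ (M - hankelIndex φ M) (hankelIndex φ M) = ⊥ := by
  classical
  exact Nat.findGreatest_spec (P := fun n => hankelKer φ (M - n) n = ⊥) (Nat.zero_le M)
    (hankelKer_zero φ _)

theorem hankelIndex_le (φ : K[X] →ₗ[K] K) (M : ℕ) : hankelIndex φ M ≤ M := by
  classical
  exact Nat.findGreatest_le M

theorem two_mul_hankelIndex_le (φ : K[X] →ₗ[K] K) (M : ℕ) : 2 * hankelIndex φ M ≤ M := by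
  have h1 := le_finrank_hankelKer φ (M - hankelIndex φ M) (hankelIndex φ M)
  rw [hankelKer_hankelIndex, finrank_bot] at h1
  have := hankelIndex_le φ M
  omega

theorem hankelKer_eq_bot_iff (φ : K[X] →ₗ[K] K) (b k : ℕ) :
    hankelKer φ b k = ⊥ ↔ k ≤ hankelIndex φ (b + k) := by
  classical
  constructor
  · intro h
    exact Nat.le_findGreatest (by omega) (by simpa using h)
  · intro h
    rw [eq_bot_iff, ← hankelKer_hankelIndex φ (b + k)]
    exact hankelKer_mono φ (by omega) h

theorem add_finrank_hankelKer_of_le_hankelIndex (φ : K[X] →ₗ[K] K) {b k : ℕ}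
    (h : b ≤ hankelIndex φ (b + k)) : b + Module.finrank K (hankelKer φ b k) = k := by
  rw [finrank_hankelKer_comm, (hankelKer_eq_bot_iff φ k b).2 (by rwa [add_comm]), finrank_bot,
    add_zero]

/-- A Hankel matrix whose index is not extremal has a principal kernel. -/
theorem exists_hankelKer_eq_map (φ : K[X] →ₗ[K] K) {b k : ℕ} (hk : hankelIndex φ (b + k) < k)
    (hb : hankelIndex φ (b + k) ≤ b) :
    ∃ f ≠ 0, f ∈ degreeLT K (hankelIndex φ (b + k) + 1) ∧
      hankelKer φ b k =
        (degreeLT K (k - hankelIndex φ (b + k))).map (LinearMap.mulLeft K f) := by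
  have h1 := hankelKer_hankelIndex φ (b + k)
  have h2 := hankelKer_eq_bot_iff φ (b + k - hankelIndex φ (b + k) - 1)
    (hankelIndex φ (b + k) + 1)
  rw [show b + k - hankelIndex φ (b + k) - 1 + (hankelIndex φ (b + k) + 1) = b + k by omega] at h2
  generalize hankelIndex φ (b + k) = d at *
  obtain ⟨f, hf, hf0⟩ := Submodule.exists_mem_ne_zero_of_ne_bot
    (fun h => absurd (h2.1 h) (by omega))
  refine ⟨f, hf0, hf.1, ?_⟩
  have e : b + k - d = d + (k - d) + (b - d) := by omega
  rw [e] at h1 hf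
  have := hankelKer_eq_map h1 hf hf0
  rwa [show d + (b - d) = b by omega, show d + (k - d) = k by omega] at this

theorem finrank_hankelKer_of_hankelIndex (φ : K[X] →ₗ[K] K) {b k : ℕ}
    (hk : hankelIndex φ (b + k) < k) (hb : hankelIndex φ (b + k) ≤ b) :
    Module.finrank K (hankelKer φ b k) = k - hankelIndex φ (b + k) := by
  obtain ⟨f, hf0, -, hf⟩ := exists_hankelKer_eq_map φ hk hb
  rw [hf, ← (Submodule.equivMapOfInjective _ (mul_right_injective₀ hf0) _).finrank_eq,
    finrank_degreeLT']

end Structure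

section Sequences

variable {K : Type*} [Field K]

/-- The functional `X ^ i ↦ β i`, extended by zero. -/
noncomputable def seqFunctional {N : ℕ} (β : Fin N → K) : K[X] →ₗ[K] K :=
  ∑ i, β i • lcoeff K i

theorem seqFunctional_X_pow {N : ℕ} (β : Fin N → K) {i : ℕ} (h : i < N) :
    seqFunctional β (X ^ i) = β ⟨i, h⟩ := by
  rw [seqFunctional, LinearMap.sum_apply, Finset.sum_eq_single ⟨i, h⟩]
  · simp
  · intro j _ hj
    have : (j : ℕ) ≠ i := fun hji => hj (Fin.ext hji)
    simp [coeff_X_pow, this]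
  · simp

theorem seqFunctional_eq {N : ℕ} {β : Fin N → K} {φ : K[X] →ₗ[K] K}
    (h : ∀ i, β i = φ (X ^ (i : ℕ))) {p : K[X]} (hp : p ∈ degreeLT K N) :
    seqFunctional β p = φ p :=
  eqOn_degreeLT (fun i hi => by rw [seqFunctional_X_pow β hi, h]) hp

/-- The first `N` values of the sequence obtained from `β` by the action of `f`. -/
noncomputable def hankelContract (f : K[X]) {L : ℕ} (N : ℕ) : (Fin L → K) →+ (Fin N → K) where
  toFun β i := seqFunctional β (f * X ^ (i : ℕ))
  map_zero' := by ext; simp [seqFunctional]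
  map_add' β γ := by ext; simp [seqFunctional, add_mul, Finset.sum_add_distrib]

theorem seqFunctional_hankelContract (f : K[X]) {L N : ℕ} (β : Fin L → K) {p : K[X]}
    (hp : p ∈ degreeLT K N) :
    seqFunctional (hankelContract f N β) p = seqFunctional β (f * p) :=
  seqFunctional_eq (φ := seqFunctional β ∘ₗ LinearMap.mulLeft K f) (fun _ => rfl) hp

theorem hankelContract_surjective {f : K[X]} {d N L : ℕ} (hf0 : f ≠ 0) (hf : f ∈ degreeLT K (d + 1))
    (hL : N + d ≤ L) : Function.Surjective (hankelContract f N : (Fin L → K) →+ (Fin N → K)) := by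
  intro γ
  obtain ⟨g, hg⟩ := LinearMap.exists_leftInverse_of_injective (LinearMap.mulLeft K f)
    (LinearMap.ker_eq_bot.2 (mul_right_injective₀ hf0))
  refine ⟨fun i => seqFunctional γ (g (X ^ (i : ℕ))), funext fun i => ?_⟩
  change seqFunctional _ (f * X ^ (i : ℕ)) = γ i
  rw [seqFunctional_eq (β := fun i : Fin L => seqFunctional γ (g (X ^ (i : ℕ))))
    (φ := seqFunctional γ ∘ₗ g) (fun _ => rfl)
    (mul_mem_degreeLT hf (X_pow_mem_degreeLT i.2) (by omega))]
  have := LinearMap.congr_fun hg (X ^ (i : ℕ))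
  simp only [LinearMap.comp_apply, LinearMap.mulLeft_apply, LinearMap.id_apply] at this
  rw [LinearMap.comp_apply, this, seqFunctional_X_pow γ i.2]

end Sequences

section Counting

theorem card_filter_comp_surjective {V W : Type*} [AddCommGroup V] [AddCommGroup W] [Fintype V]
    [Fintype W] (T : V →+ W) (hT : Function.Surjective T) (P : W → Prop) [DecidablePred P] {c : ℕ}
    (hc : Fintype.card V = c * Fintype.card W) :
    (Finset.univ.filter fun v => P (T v)).card = c * (Finset.univ.filter P).card := by
  classical
  have key : ∀ (s : Finset W), (Finset.univ.filter fun v => T v ∈ s).card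
      = s.card * (Finset.univ.filter fun v => T v = 0).card := by
    intro s
    rw [Finset.card_eq_sum_card_fiberwise (f := T) (t := s) (fun v hv => by simpa using hv),
      Finset.sum_const_nat]
    intro w hw
    rw [Finset.filter_filter,
      AddMonoidHom.card_fiber_eq_of_mem_range T (x := 0) (hT 0) (hT w)]
    congr 1
    ext v
    simp only [Finset.mem_filter, Finset.mem_univ, true_and]
    constructor
    · exact fun h => h.2
    · rintro rfl
      exact ⟨hw, rfl⟩
  have h1 := key Finset.univ
  simp only [Finset.mem_univ, Finset.filter_true, Finset.card_univ] at h1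
  have h2 := key (Finset.univ.filter P)
  simp only [Finset.mem_filter, Finset.mem_univ, true_and] at h2
  rw [h2]
  have : Fintype.card W ≠ 0 := Fintype.card_ne_zero
  have h3 : (Finset.univ.filter fun v => T v = 0).card = c := by
    apply Nat.eq_of_mul_eq_mul_left (Nat.pos_of_ne_zero this)
    rw [← h1, hc, mul_comm]
  rw [h3, mul_comm]

open Classical in
theorem card_filter_hankelContract {f : (ZMod 2)[X]} {d N L : ℕ} (hf0 : f ≠ 0)
    (hf : f ∈ degreeLT (ZMod 2) (d + 1)) (hL : L = N + d) (P : (Fin N → ZMod 2) → Prop) :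
    (Finset.univ.filter fun β : Fin L → ZMod 2 => P (hankelContract f N β)).card
      = 2 ^ d * (Finset.univ.filter P).card := by
  refine card_filter_comp_surjective _ (hankelContract_surjective hf0 hf hL.ge) P ?_
  simp [hL, pow_add, mul_comm]

theorem natCard_eq_two_pow (V : Submodule (ZMod 2) (ZMod 2)[X]) [FiniteDimensional (ZMod 2) V] :
    Nat.card V = 2 ^ Module.finrank (ZMod 2) V := by
  rw [Module.natCard_eq_pow_finrank (K := ZMod 2), Nat.card_zmod]

/-- First moment of the size of the kernel of a random Hankel matrix. -/
theorem sum_card_hankelKer {N d : ℕ} (hd : d ≤ N) :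
    ∑ β : Fin N → ZMod 2, Nat.card (hankelKer (seqFunctional β) (N - d) (d + 1))
      = 2 ^ N + (2 ^ (d + 1) - 1) * 2 ^ d := by
  classical
  let e := degreeLTEquiv (ZMod 2) (d + 1)
  have h1 : ∀ β : Fin N → ZMod 2, Nat.card (hankelKer (seqFunctional β) (N - d) (d + 1))
      = (Finset.univ.filter fun c : Fin (d + 1) → ZMod 2 =>
          (e.symm c : (ZMod 2)[X]) ∈ hankelKer (seqFunctional β) (N - d) (d + 1)).card := by
    intro β
    rw [← Fintype.card_subtype, ← Nat.card_eq_fintype_card]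
    refine Nat.card_congr
      { toFun := fun p => ⟨e ⟨p, hankelKer_le _ _ _ p.2⟩, by simp⟩
        invFun := fun c => ⟨e.symm c, c.2⟩
        left_inv := fun p => by simp
        right_inv := fun c => by simp }
  simp only [h1]
  have h2 := Finset.sum_card_bipartiteAbove_eq_sum_card_bipartiteBelow
    (fun (β : Fin N → ZMod 2) (c : Fin (d + 1) → ZMod 2) =>
      (e.symm c : (ZMod 2)[X]) ∈ hankelKer (seqFunctional β) (N - d) (d + 1))
    (s := Finset.univ) (t := Finset.univ)
  simp only [Finset.bipartiteAbove, Finset.bipartiteBelow] at h2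
  rw [h2, ← Finset.add_sum_erase _ _ (Finset.mem_univ 0)]
  congr 1
  · simp
  rw [Finset.sum_const_nat (m := 2 ^ d)]
  · simp [Finset.card_erase_of_mem]
  intro c hc
  have hc0 : (e.symm c : (ZMod 2)[X]) ≠ 0 := by
    simpa using hc
  have h3 := (card_filter_hankelContract (L := N) (N := N - d) hc0 (e.symm c).2 (by omega)
    (fun γ => γ = 0)).trans (congrArg _ (Finset.card_eq_one.2 ⟨0, by ext; simp⟩))
  rw [mul_one] at h3
  rw [← h3]
  congr 1
  ext β
  simp only [Finset.mem_filter, Finset.mem_univ, true_and, mem_hankelKer,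
    and_iff_right (Subtype.prop _)]
  rw [funext_iff, Fin.forall_iff]
  rfl

theorem card_filter_lt_hankelIndex {N n : ℕ} (h : 2 * n + 1 ≤ N) :
    (Finset.univ.filter fun β : Fin N → ZMod 2 =>
      n + 1 ≤ hankelIndex (seqFunctional β) (N + 1)).card + 2 ^ (2 * n) = 2 ^ N := by
  classical
  have key : ∀ β : Fin N → ZMod 2,
      Nat.card (hankelKer (seqFunctional β) (N - n) (n + 1))
        + (if n + 1 ≤ hankelIndex (seqFunctional β) (N + 1) then 1 else 0)
      = 2 * Nat.card (hankelKer (seqFunctional β) (N + 1 - n) n) := by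
    intro β
    have e1 : N - n + (n + 1) = N + 1 := by omega
    have e2 : N + 1 - n + n = N + 1 := by omega
    have h1 := hankelKer_eq_bot_iff (seqFunctional β) (N - n) (n + 1)
    have h2 := hankelKer_eq_bot_iff (seqFunctional β) (N + 1 - n) n
    rw [e1] at h1
    rw [e2] at h2
    split_ifs with hi
    · rw [h1.2 hi, h2.2 (by omega)]
      simp
    · have f1 := finrank_hankelKer_of_hankelIndex (seqFunctional β) (b := N - n) (k := n + 1)
        (by rw [e1]; omega) (by rw [e1]; omega)
      have f2 : Module.finrank (ZMod 2) (hankelKer (seqFunctional β) (N + 1 - n) n)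
          = n - hankelIndex (seqFunctional β) (N + 1) := by
        rcases (Nat.lt_succ_iff.1 (not_le.1 hi)).eq_or_lt with h0 | h0
        · rw [h2.2 h0.ge, finrank_bot]
          omega
        · have := finrank_hankelKer_of_hankelIndex (seqFunctional β) (b := N + 1 - n) (k := n)
            (by rw [e2]; omega) (by rw [e2]; omega)
          rwa [e2] at this
      rw [e1] at f1
      rw [natCard_eq_two_pow, natCard_eq_two_pow, f1, f2, add_zero, ← pow_succ']
      congr 1
      omega
  have hsum := Finset.sum_congr (rfl : (Finset.univ : Finset (Fin N → ZMod 2)) = _)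
    fun β _ => key β
  rw [Finset.sum_add_distrib, sum_card_hankelKer (by omega), ← Finset.card_filter,
    ← Finset.mul_sum] at hsum
  cases n with
  | zero =>
    simp only [hankelKer_zero] at hsum
    simp at hsum ⊢
    omega
  | succ n =>
    have e : N + 1 - (n + 1) = N - n := by omega
    rw [e, sum_card_hankelKer (by omega)] at hsum
    have p1 : 1 ≤ 2 ^ (n + 1 + 1) := Nat.one_le_two_pow
    have p2 : 1 ≤ 2 ^ (n + 1) := Nat.one_le_two_pow
    zify [p1, p2] at hsum ⊢
    have e3 : (2 : ℤ) ^ (2 * (n + 1)) = 4 * (2 ^ n) ^ 2 := by ring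
    rw [e3]
    ring_nf at hsum ⊢
    linarith

/-- The number of sequences of length `N` of given index. -/
noncomputable def indexCount (N d : ℕ) : ℕ :=
  (Finset.univ.filter fun β : Fin N → ZMod 2 =>
    hankelIndex (seqFunctional β) (N + 1) = d).card

theorem indexCount_add (N d : ℕ) :
    indexCount N d + (Finset.univ.filter fun β : Fin N → ZMod 2 =>
      d + 1 ≤ hankelIndex (seqFunctional β) (N + 1)).card
    = (Finset.univ.filter fun β : Fin N → ZMod 2 =>
      d ≤ hankelIndex (seqFunctional β) (N + 1)).card := by
  classical
  rw [indexCount, ← Finset.card_union_of_disjoint]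
  · congr 1
    ext β
    simp only [Finset.mem_union, Finset.mem_filter, Finset.mem_univ, true_and]
    omega
  · rw [Finset.disjoint_filter]
    intro β _ h
    omega

theorem card_filter_lt_hankelIndex_add_two (N n : ℕ) :
    (Finset.univ.filter fun β : Fin (N + 2) → ZMod 2 =>
      n + 1 + 1 ≤ hankelIndex (seqFunctional β) (N + 2 + 1)).card
    = 4 * (Finset.univ.filter fun β : Fin N → ZMod 2 =>
      n + 1 ≤ hankelIndex (seqFunctional β) (N + 1)).card := by
  by_cases h : 2 * n + 1 ≤ N
  · have h1 := card_filter_lt_hankelIndex h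
    have h2 := card_filter_lt_hankelIndex (N := N + 2) (n := n + 1) (by omega)
    have e1 : 2 ^ (N + 2) = 4 * 2 ^ N := by ring
    have e2 : 2 ^ (2 * (n + 1)) = 4 * 2 ^ (2 * n) := by ring
    rw [e1, e2] at h2
    omega
  · rw [Finset.filter_false_of_mem, Finset.filter_false_of_mem]
    · simp
    · intro β _
      have := two_mul_hankelIndex_le (seqFunctional β) (N + 1)
      omega
    · intro β _
      have := two_mul_hankelIndex_le (seqFunctional β) (N + 2 + 1)
      omega

theorem indexCount_add_two (N : ℕ) {d : ℕ} (hd : 1 ≤ d) :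
    indexCount (N + 2) (d + 1) = 4 * indexCount N d := by
  obtain ⟨d, rfl⟩ := Nat.exists_eq_add_of_le' hd
  have h1 := indexCount_add (N + 2) (d + 1 + 1)
  have h2 := indexCount_add N (d + 1)
  rw [card_filter_lt_hankelIndex_add_two N (d + 1), card_filter_lt_hankelIndex_add_two N d] at h1
  omega

end Counting

section Stacking

variable {K : Type*} [Field K]

/-- A functional vanishing on the kernel of a Hankel matrix lies in its row space. -/
theorem exists_mul_of_hankelKer_le_ker {φ ψ : K[X] →ₗ[K] K} {b k : ℕ}
    (h : ∀ v ∈ hankelKer φ b k, ψ v = 0) :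
    ∃ c ∈ degreeLT K b, ∀ w ∈ degreeLT K k, ψ w = φ (c * w) := by
  have key : ψ ∘ₗ (degreeLT K k).subtype ∈ Submodule.span K (Set.range fun i : Fin b =>
      (φ ∘ₗ LinearMap.mulRight K (X ^ (i : ℕ))) ∘ₗ (degreeLT K k).subtype) := by
    refine mem_span_of_iInf_ker_le_ker fun v hv => h v ⟨v.2, fun i hi => ?_⟩
    rw [Submodule.mem_iInf] at hv
    exact hv ⟨i, hi⟩
  rw [Submodule.mem_span_range_iff_exists_fun] at key
  obtain ⟨c, hc⟩ := key
  refine ⟨∑ i : Fin b, c i • X ^ (i : ℕ), Submodule.sum_mem _ fun i _ =>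
    Submodule.smul_mem _ _ (X_pow_mem_degreeLT i.2), fun w hw => ?_⟩
  have := LinearMap.congr_fun hc ⟨w, hw⟩
  simp only [LinearMap.sum_apply, LinearMap.smul_apply, LinearMap.comp_apply,
    Submodule.subtype_apply, LinearMap.mulRight_apply] at this
  rw [← this, Finset.sum_mul, map_sum]
  refine Finset.sum_congr rfl fun i _ => ?_
  rw [smul_mul_assoc, map_smul, mul_comm w]

theorem exists_mul_of_hankelKer_le {φ ψ : K[X] →ₗ[K] K} {a b k : ℕ} (ha : 1 ≤ a)
    (hab : a ≤ b + 1) (hk : 1 ≤ k) (hbot : hankelKer φ (k - 1) (b + 1) = ⊥)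
    (h : hankelKer φ b k ≤ hankelKer ψ a k) :
    ∃ c ∈ degreeLT K (b + 1 - a), ∀ i < a + k - 1, ψ (X ^ i) = φ (c * X ^ i) := by
  have row : ∀ i, ∃ c ∈ degreeLT K b, i < a → ∀ w ∈ degreeLT K k,
      ψ (w * X ^ i) = φ (c * w) := by
    intro i
    by_cases hi : i < a
    · obtain ⟨c, hc, hcw⟩ := exists_mul_of_hankelKer_le_ker
        (ψ := ψ ∘ₗ LinearMap.mulRight K (X ^ i)) fun v hv => (h hv).2 i hi
      exact ⟨c, hc, fun _ => hcw⟩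
    · exact ⟨0, zero_mem _, fun h => absurd h hi⟩
  choose c hcb hc using row
  have hpow : ∀ i < a, c i = c 0 * X ^ i := by
    intro i
    induction i with
    | zero => simp
    | succ i ih =>
      intro hi
      rw [pow_succ, ← mul_assoc, ← ih (by omega), ← sub_eq_zero, ← Submodule.mem_bot K, ← hbot]
      have hX : (X : K[X]) ∈ degreeLT K 2 := by
        simpa using X_pow_mem_degreeLT (K := K) one_lt_two
      refine ⟨sub_mem (degreeLT_mono b.le_succ (hcb _))
        (mul_mem_degreeLT (hcb i) hX le_rfl), fun j hj => ?_⟩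
      have e1 := hc (i + 1) hi (X ^ j) (X_pow_mem_degreeLT (by omega))
      have e2 := hc i (by omega) (X ^ (j + 1)) (X_pow_mem_degreeLT (by omega))
      rw [sub_mul, map_sub, ← e1, mul_assoc, ← pow_succ', ← e2, ← pow_add, ← pow_add, sub_eq_zero,
        show j + (i + 1) = j + 1 + i by omega]
  refine ⟨c 0, ?_, fun i hi => ?_⟩
  · refine mem_degreeLT_of_mul_mem (f := X ^ (a - 1)) (by simp) ?_
    rw [mul_comm, ← hpow _ (by omega), natDegree_X_pow]
    convert hcb (a - 1) using 2
    omega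
  · obtain ⟨i₁, i₂, h₁, h₂, rfl⟩ : ∃ i₁ i₂, i₁ < a ∧ i₂ < k ∧ i = i₂ + i₁ := by
      rcases lt_or_ge i a with h' | h'
      · exact ⟨i, 0, h', by omega, by omega⟩
      · exact ⟨a - 1, i - (a - 1), by omega, by omega, by omega⟩
    rw [pow_add, hc i₁ h₁ _ (X_pow_mem_degreeLT h₂), hpow _ h₁]
    ring_nf

end Stacking

section StackCounting

/-- The number of `a × n` Hankel matrices over `F_2` with kernel of dimension `e`. -/
noncomputable def kerCount (a n e : ℕ) : ℕ :=
  (Finset.univ.filter fun α : Fin (a + n - 1) → ZMod 2 =>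
    Module.finrank (ZMod 2) (hankelKer (seqFunctional α) a n) = e).card

theorem kerCount_eq_zero {a n e : ℕ} (h : a + e < n) : kerCount a n e = 0 := by
  rw [kerCount, Finset.card_eq_zero, Finset.filter_eq_empty_iff]
  intro α _ hα
  have := le_finrank_hankelKer (seqFunctional α) a n
  omega

/-- The number of sequences `α` such that stacking the `a × k` Hankel matrix of `α` on a `b × k`
Hankel matrix of index `d` gives a matrix with kernel of dimension `e`. -/
noncomputable def stackCount (a b k e d : ℕ) : ℕ :=
  if d < k then
    if d ≤ b then 2 ^ d * kerCount a (k - d) e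
    else if e + b = k then 2 ^ (b + 1 - a) else 0
  else if e = 0 then 2 ^ (a + k - 1) else 0

theorem finrank_inf_eq {K : Type*} [Field K] {a k d L : ℕ} {f : K[X]} (hf0 : f ≠ 0)
    (hf : f ∈ degreeLT K (d + 1)) (hd : d < k) (α : Fin L → K) :
    Module.finrank K ↥(hankelKer (seqFunctional α) a k ⊓
        (degreeLT K (k - d)).map (LinearMap.mulLeft K f))
      = Module.finrank K (hankelKer
        (seqFunctional (hankelContract f (a + (k - d) - 1) α)) a (k - d)) := by
  have e : hankelKer (seqFunctional α) a k ⊓ (degreeLT K (k - d)).map (LinearMap.mulLeft K f)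
      = (hankelKer (seqFunctional (hankelContract f (a + (k - d) - 1) α)) a (k - d)).map
        (LinearMap.mulLeft K f) := by
    have key : ∀ p ∈ degreeLT K (k - d), ∀ i < a,
        seqFunctional (hankelContract f (a + (k - d) - 1) α) (p * X ^ i)
          = seqFunctional α (f * p * X ^ i) := by
      intro p hp i hi
      rw [seqFunctional_hankelContract, mul_assoc]
      exact mul_mem_degreeLT hp (X_pow_mem_degreeLT hi) (by omega)
    ext v
    constructor
    · rintro ⟨hv, p, hp, rfl⟩
      exact ⟨p, ⟨hp, fun i hi => (key p hp i hi).trans (hv.2 i hi)⟩, rfl⟩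
    · rintro ⟨p, hp, rfl⟩
      exact ⟨⟨mul_mem_degreeLT hf hp.1 (by omega), fun i hi =>
        (key p hp.1 i hi).symm.trans (hp.2 i hi)⟩, p, hp.1, rfl⟩
  rw [e, ← (Submodule.equivMapOfInjective _ (mul_right_injective₀ hf0) _).finrank_eq]

open Classical in
theorem card_filter_hankelKer_le {a b k : ℕ} (ha : 1 ≤ a) (hab : a ≤ b + 1) (hk : 1 ≤ k)
    {β : Fin (b + k - 1) → ZMod 2} (hβ : b < hankelIndex (seqFunctional β) (b + k)) :
    (Finset.univ.filter fun α : Fin (a + k - 1) → ZMod 2 =>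
      hankelKer (seqFunctional β) b k ≤ hankelKer (seqFunctional α) a k).card
      = 2 ^ (b + 1 - a) := by
  have hbot : ∀ b' k', b' + k' = b + k → k' ≤ b + 1 → hankelKer (seqFunctional β) b' k' = ⊥ := by
    intro b' k' h h'
    rw [hankelKer_eq_bot_iff, h]
    omega
  let e := degreeLTEquiv (ZMod 2) (b + 1 - a)
  let F : (Fin (b + 1 - a) → ZMod 2) → (Fin (a + k - 1) → ZMod 2) := fun c =>
    hankelContract (e.symm c : (ZMod 2)[X]) (a + k - 1) β
  have hF : Function.Injective F := by
    intro c c' hcc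
    apply e.symm.injective
    apply Subtype.ext
    rw [← sub_eq_zero, ← Submodule.mem_bot (ZMod 2),
      ← hbot (a + k - 1) (b + 1 - a) (by omega) (by omega)]
    refine ⟨sub_mem (Subtype.prop _) (Subtype.prop _), fun i hi => ?_⟩
    rw [sub_mul, map_sub, sub_eq_zero]
    exact congrFun hcc ⟨i, hi⟩
  have himg : (Finset.univ.filter fun α : Fin (a + k - 1) → ZMod 2 =>
      hankelKer (seqFunctional β) b k ≤ hankelKer (seqFunctional α) a k)
      = Finset.univ.image F := by
    ext α
    simp only [Finset.mem_filter, Finset.mem_univ, true_and, Finset.mem_image]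
    constructor
    · intro h
      obtain ⟨c, hc, hα⟩ := exists_mul_of_hankelKer_le ha hab hk
        (hbot _ _ (by omega) le_rfl) h
      refine ⟨e ⟨c, hc⟩, funext fun i => ?_⟩
      have := hα i i.2
      rw [seqFunctional_X_pow α i.2] at this
      simp only [F, LinearEquiv.symm_apply_apply]
      exact this.symm
    · rintro ⟨c, rfl⟩ v hv
      refine ⟨hv.1, fun i hi => ?_⟩
      rw [seqFunctional_hankelContract _ _
        (mul_mem_degreeLT hv.1 (X_pow_mem_degreeLT hi) (by omega)), mul_left_comm]
      exact apply_mul_of_mem_hankelKer hv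
        (mul_mem_degreeLT (e.symm c).2 (X_pow_mem_degreeLT hi) (by omega))
  rw [himg, Finset.card_image_of_injective _ hF]
  simp

theorem card_filter_finrank_inf {a b k e : ℕ} (ha : 1 ≤ a) (hab : a ≤ b + 1)
    (hk : k ≤ e + b) (β : Fin (b + k - 1) → ZMod 2) :
    (Finset.univ.filter fun α : Fin (a + k - 1) → ZMod 2 =>
      Module.finrank (ZMod 2)
        ↥(hankelKer (seqFunctional α) a k ⊓ hankelKer (seqFunctional β) b k) = e).card
      = stackCount a b k e (hankelIndex (seqFunctional β) (b + k)) := by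
  classical
  unfold stackCount
  split_ifs with h1 h2 h3 h3
  · obtain ⟨f, hf0, hf, hker⟩ := exists_hankelKer_eq_map _ h1 h2
    rw [hker]
    simp only [finrank_inf_eq hf0 hf h1]
    unfold kerCount
    convert card_filter_hankelContract hf0 hf _ (fun γ => Module.finrank (ZMod 2)
      (hankelKer (seqFunctional γ) a (k - hankelIndex (seqFunctional β) (b + k))) = e)
    omega
  · rw [← card_filter_hankelKer_le ha hab (by omega) (not_le.1 h2)]
    congr 1
    ext α
    simp only [Finset.mem_filter, Finset.mem_univ, true_and]
    have hfr := add_finrank_hankelKer_of_le_hankelIndex _ (not_le.1 h2).le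
    constructor
    · intro h
      rw [← inf_eq_right]
      exact Submodule.eq_of_le_of_finrank_le inf_le_right (by omega)
    · intro h
      rw [inf_eq_right.2 h]
      omega
  · rw [Finset.card_eq_zero, Finset.filter_eq_empty_iff]
    intro α _ h
    have hfr := add_finrank_hankelKer_of_le_hankelIndex _ (not_le.1 h2).le
    have := Submodule.finrank_mono (inf_le_right :
      hankelKer (seqFunctional α) a k ⊓ hankelKer (seqFunctional β) b k ≤ _)
    omega
  · rw [(hankelKer_eq_bot_iff (seqFunctional β) b k).2 (not_lt.1 h1)]
    simp [h3]
  · rw [(hankelKer_eq_bot_iff (seqFunctional β) b k).2 (not_lt.1 h1)]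
    rw [Finset.card_eq_zero, Finset.filter_eq_empty_iff]
    intro α _
    rw [inf_bot_eq, finrank_bot]
    exact Ne.symm h3

theorem stackCount_succ {a b k e d : ℕ} (ha : 1 ≤ a) (hab : a ≤ b + 1) :
    stackCount a (b + 1) (k + 1) e (d + 1) = 2 * stackCount a b k e d := by
  unfold stackCount
  simp only [Nat.add_lt_add_iff_right, Nat.add_le_add_iff_right, Nat.add_sub_add_right,
    ← add_assoc, Nat.add_right_cancel_iff]
  rw [show b + 1 + 1 - a = b + 1 - a + 1 by omega, show a + k + 1 - 1 = a + k - 1 + 1 by omega]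
  split_ifs <;> ring

/-- The number of pairs of sequences whose stacked Hankel matrices have a kernel of dimension
`e`. -/
noncomputable def pairCount (a b k e : ℕ) : ℕ :=
  Nat.card {p : (Fin (a + k - 1) → ZMod 2) × (Fin (b + k - 1) → ZMod 2) //
    Module.finrank (ZMod 2)
      ↥(hankelKer (seqFunctional p.1) a k ⊓ hankelKer (seqFunctional p.2) b k) = e}

theorem pairCount_eq_sum {a b k e : ℕ} (n : ℕ) (ha : 1 ≤ a) (hab : a ≤ b + 1) (hk0 : 1 ≤ k)
    (hk : k ≤ e + b) (hn : b + k < n) :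
    pairCount a b k e
      = ∑ d ∈ Finset.range n, indexCount (b + k - 1) d * stackCount a b k e d := by
  classical
  rw [pairCount, Nat.card_eq_fintype_card, Fintype.card_subtype, Finset.card_filter,
    ← Finset.univ_product_univ, Finset.sum_product_right]
  simp only [← Finset.card_filter, card_filter_finrank_inf ha hab hk]
  rw [← Finset.sum_fiberwise_of_maps_to (s := Finset.univ) (t := Finset.range n)
    (g := fun β : Fin (b + k - 1) → ZMod 2 => hankelIndex (seqFunctional β) (b + k))]
  · refine Finset.sum_congr rfl fun d _ => ?_
    have e1 : b + k - 1 + 1 = b + k := by omega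
    rw [indexCount, e1, Finset.sum_const_nat]
    intro β hβ
    rw [(Finset.mem_filter.1 hβ).2]
  · intro β _
    have := hankelIndex_le (seqFunctional β) (b + k)
    exact Finset.mem_range.2 (by omega)

theorem pairCount_succ {a b k e : ℕ} (ha : 1 ≤ a) (hak : a + e < k) (hk : k ≤ e + b) :
    pairCount a (b + 1) (k + 1) e = 8 * pairCount a b k e := by
  have z : ∀ b k d, d < k → d ≤ b → a + e < k - d → stackCount a b k e d = 0 := by
    intro b k d h1 h2 h3
    rw [stackCount, if_pos h1, if_pos h2, kerCount_eq_zero h3, mul_zero]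
  rw [pairCount_eq_sum (b + k + 2 + 1) ha (by omega) (by omega) (by omega) (by omega),
    pairCount_eq_sum (b + k + 2) ha (by omega) (by omega) (by omega) (by omega),
    Finset.sum_range_succ', z _ _ 0 (by omega) (by omega) (by omega), mul_zero, add_zero,
    Finset.mul_sum]
  refine Finset.sum_congr rfl fun d _ => ?_
  rw [stackCount_succ ha (by omega)]
  rcases Nat.eq_zero_or_pos d with rfl | hd
  · rw [z _ _ 0 (by omega) (by omega) (by omega)]
    simp
  · rw [show b + 1 + (k + 1) - 1 = b + k - 1 + 2 by omega, indexCount_add_two _ hd]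
    ring

theorem pairCount_add {a b k e : ℕ} (n : ℕ) (ha : 1 ≤ a) (hak : a + e < k) (hk : k ≤ e + b) :
    pairCount a (b + n) (k + n) e = 8 ^ n * pairCount a b k e := by
  induction n with
  | zero => simp
  | succ n ih =>
    rw [← add_assoc, ← add_assoc, pairCount_succ ha (by omega) (by omega), ih]
    ring

end StackCounting

theorem Gamma_eq_pairCount {a b k r : ℕ} (hr : r ≤ k) :
    Gamma a b k r = pairCount a b k (k - r) := by
  refine Nat.card_congr (Equiv.subtypeEquivRight fun p => ?_)
  have := rank_add_finrank (Matrix.fromRows (hankel a k p.1) (hankel b k p.2))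
    (hankelKer (seqFunctional p.1) a k ⊓ hankelKer (seqFunctional p.2) b k)
    (inf_le_left.trans (hankelKer_le _ _ _)) fun v => ?_
  · omega
  have key : ∀ (c : ℕ) (γ : Fin (c + k - 1) → ZMod 2),
      ((degreeLTEquiv (ZMod 2) k).symm v : (ZMod 2)[X]) ∈ hankelKer (seqFunctional γ) c k
        ↔ (hankel c k γ).mulVec v = 0 := by
    intro c γ
    rw [mem_hankelKer, and_iff_right (Subtype.prop _), funext_iff, Fin.forall_iff]
    refine forall_congr' fun i => forall_congr' fun hi => ?_
    rw [apply_degreeLTEquiv_symm_mul]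
    have : ∀ j : Fin k, seqFunctional γ (X ^ (i + (j : ℕ))) = hankel c k γ ⟨i, hi⟩ j :=
      fun j => seqFunctional_X_pow γ (by have := j.2; omega)
    simp only [this]
    rfl
  rw [Submodule.mem_inf, key, key, Matrix.fromRows_mulVec]
  constructor
  · rintro ⟨h1, h2⟩
    rw [h1, h2]
    ext (i | i) <;> rfl
  · intro h
    exact ⟨funext fun i => congrFun h (Sum.inl i), funext fun i => congrFun h (Sum.inr i)⟩

theorem Gamma_reduction_middle (s m k j : ℕ) (hs : 2 ≤ s) (hm : 1 ≤ m) (hj1 : 1 ≤ j)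
    (hj2 : j ≤ m) (hk : s + j ≤ k) :
    Gamma s (s + m) k (s + j) = 8 ^ (j - 1) * Gamma s (s + m - j + 1) (k - j + 1) (s + 1) := by
  rw [Gamma_eq_pairCount hk, Gamma_eq_pairCount (by omega),
    show k - j + 1 - (s + 1) = k - (s + j) by omega,
    ← pairCount_add (j - 1) (by omega) (by omega) (by omega)]
  congr 1 <;> omega
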